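/- Let f : ℝⁿ → ℝ be locally Lipschitz continuous, let x, u ∈ ℝⁿ, and assume that the cone K_x(u) = ⋃_{λ ≥ 0} (λ·∂f(u) × {λ·(f(x) − f(u))}) is a closed subset of ℝⁿ × ℝ. Then exactly one of the following holds (and never both): (i) there exists a vector η ∈ ℝⁿ such that ⟨ξ, η⟩ ≤ f(x) − f(u) for every ξ ∈ ∂f(u); (ii) the pair (0, −1) belongs to K_x(u). -/

import Mathlib

open Filter Set RealInnerProductSpace

/-- Clarke's generalized directional derivative of `f` at `u` in direction `d`. -/
noncomputable def clarkeDeriv {n : ℕ} (f : EuclideanSpace ℝ (Fin n) → ℝ)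
    (u d : EuclideanSpace ℝ (Fin n)) : ℝ :=
  Filter.limsup (fun p : EuclideanSpace ℝ (Fin n) × ℝ => (f (p.1 + p.2 • d) - f p.1) / p.2)
    ((nhds u) ×ˢ (nhdsWithin 0 (Set.Ioi (0:ℝ))))

/-- Clarke's subdifferential of `f` at `u`. -/
noncomputable def clarkeSubdiff {n : ℕ} (f : EuclideanSpace ℝ (Fin n) → ℝ)
    (u : EuclideanSpace ℝ (Fin n)) : Set (EuclideanSpace ℝ (Fin n)) :=
  {ξ | ∀ d, ⟪ξ, d⟫ ≤ clarkeDeriv f u d}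

/-- The cone `K_x(u) = ⋃_{λ ≥ 0} (λ·∂f(u) × {λ·(f(x) − f(u))})`. -/
noncomputable def clarkeCone {n : ℕ} (f : EuclideanSpace ℝ (Fin n) → ℝ)
    (x u : EuclideanSpace ℝ (Fin n)) : Set (EuclideanSpace ℝ (Fin n) × ℝ) :=
  {q | ∃ l : ℝ, 0 ≤ l ∧ ∃ ξ ∈ clarkeSubdiff f u, q = (l • ξ, l * (f x - f u))}

theorem convex_clarkeSubdiff {n : ℕ} (f : EuclideanSpace ℝ (Fin n) → ℝ)
    (u : EuclideanSpace ℝ (Fin n)) : Convex ℝ (clarkeSubdiff f u) := by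
  intro ξ hξ ζ hζ a b ha hb hab d
  rw [inner_add_left, real_inner_smul_left, real_inner_smul_left]
  calc a * ⟪ξ, d⟫ + b * ⟪ζ, d⟫ ≤ a * clarkeDeriv f u d + b * clarkeDeriv f u d :=
        add_le_add (mul_le_mul_of_nonneg_left (hξ d) ha) (mul_le_mul_of_nonneg_left (hζ d) hb)
    _ = clarkeDeriv f u d := by rw [← add_mul, hab, one_mul]

theorem convex_clarkeCone {n : ℕ} (f : EuclideanSpace ℝ (Fin n) → ℝ)
    (x u : EuclideanSpace ℝ (Fin n)) : Convex ℝ (clarkeCone f x u) := by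
  rintro _ ⟨l, hl, ξ, hξ, rfl⟩ _ ⟨m, hm, ζ, hζ, rfl⟩ a b ha hb -
  have hal : 0 ≤ a * l := mul_nonneg ha hl
  have hbm : 0 ≤ b * m := mul_nonneg hb hm
  refine ⟨a * l + b * m, add_nonneg hal hbm, ?_⟩
  rcases (add_nonneg hal hbm).eq_or_lt with h | h
  · have h₁ : a * l = 0 := by linarith
    have h₂ : b * m = 0 := by linarith
    refine ⟨ξ, hξ, Prod.ext ?_ ?_⟩
    · simp [smul_smul, h₁, h₂]
    · simp [← mul_assoc, h₁, h₂]
  · refine ⟨(a * l / (a * l + b * m)) • ξ + (b * m / (a * l + b * m)) • ζ,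
      convex_clarkeSubdiff f u hξ hζ (by positivity) (by positivity)
        (by rw [← add_div, div_self h.ne']), Prod.ext ?_ ?_⟩
    · simp only [Prod.fst_add, Prod.smul_fst, smul_add, smul_smul, mul_div_cancel₀ _ h.ne']
    · simp only [Prod.snd_add, Prod.smul_snd, smul_eq_mul]
      ring

/-- If `(0, -1)` is outside the closed cone, a separating functional yields a solution `η`. -/
theorem exists_inner_le_of_notMem_clarkeCone {n : ℕ} {f : EuclideanSpace ℝ (Fin n) → ℝ}
    {x u : EuclideanSpace ℝ (Fin n)} (hK : IsClosed (clarkeCone f x u))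
    (h : ((0 : EuclideanSpace ℝ (Fin n)), (-1 : ℝ)) ∉ clarkeCone f x u) :
    ∃ η : EuclideanSpace ℝ (Fin n), ∀ ξ ∈ clarkeSubdiff f u, ⟪ξ, η⟫ ≤ f x - f u := by
  rcases (clarkeSubdiff f u).eq_empty_or_nonempty with hempty | ⟨ξ₀, hξ₀⟩
  · exact ⟨0, by simp [hempty]⟩
  obtain ⟨g, r, hg, hr⟩ := geometric_hahn_banach_closed_point (convex_clarkeCone f x u) hK h
  have hr0 : 0 < r := by
    have h₀ := hg 0 ⟨0, le_rfl, ξ₀, hξ₀, by ext <;> simp⟩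
    rwa [map_zero] at h₀
  have hle : ∀ ξ ∈ clarkeSubdiff f u, g (ξ, f x - f u) ≤ 0 := by
    intro ξ hξ
    by_contra! hpos
    have := hg _ ⟨r / g (ξ, f x - f u), by positivity, ξ, hξ, rfl⟩
    rw [← smul_eq_mul (b := f x - f u), ← Prod.smul_mk, map_smul, smul_eq_mul,
      div_mul_cancel₀ _ hpos.ne'] at this
    exact this.false
  have hsplit : ∀ (ξ : EuclideanSpace ℝ (Fin n)) (t : ℝ), g (ξ, t) = g (ξ, 0) - t * g (0, -1) := by
    intro ξ t
    rw [← smul_eq_mul, ← map_smul, ← map_sub]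
    simp
  have hs : 0 < g (0, -1) := hr0.trans hr
  refine ⟨(g (0, -1))⁻¹ • (InnerProductSpace.toDual ℝ (EuclideanSpace ℝ (Fin n))).symm
    (g.comp (ContinuousLinearMap.inl ℝ _ ℝ)), fun ξ hξ => ?_⟩
  have hξ' := hle ξ hξ
  rw [hsplit] at hξ'
  rw [real_inner_smul_right, real_inner_comm, InnerProductSpace.toDual_symm_apply,
    inv_mul_le_iff₀ hs]
  simp only [ContinuousLinearMap.comp_apply, ContinuousLinearMap.inl_apply]
  linarith

theorem stmt0 {n : ℕ} (f : EuclideanSpace ℝ (Fin n) → ℝ) (hf : LocallyLipschitz f)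
    (x u : EuclideanSpace ℝ (Fin n)) (hK : IsClosed (clarkeCone f x u)) :
    Xor' (∃ η : EuclideanSpace ℝ (Fin n), ∀ ξ ∈ clarkeSubdiff f u, ⟪ξ, η⟫ ≤ f x - f u)
      (((0 : EuclideanSpace ℝ (Fin n)), (-1 : ℝ)) ∈ clarkeCone f x u) := by
  by_cases h : ((0 : EuclideanSpace ℝ (Fin n)), (-1 : ℝ)) ∈ clarkeCone f x u
  · refine Or.inr ⟨h, ?_⟩
    rintro ⟨η, hη⟩
    obtain ⟨l, hl, ξ, hξ, heq⟩ := h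
    obtain ⟨h₁, h₂⟩ := Prod.mk.inj heq
    have hl0 : l ≠ 0 := by
      rintro rfl
      norm_num at h₂
    have hξ0 : ξ = 0 := (smul_eq_zero.mp h₁.symm).resolve_left hl0
    have h₃ := hη ξ hξ
    rw [hξ0, inner_zero_left] at h₃
    linarith [mul_nonneg hl h₃]
  · exact Or.inl ⟨exists_inner_le_of_notMem_clarkeCone hK h, h⟩
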